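/- arXiv:2503.03357 — 3 statements merged into one kernel-verified Lean document; each statement's English description precedes it below -/
import Mathlib

section
/- Let n ∈ ℕ and let A, B ∈ ℝ_max^{n×n} be such that every entry of A* and of B* lies in ℝ_max (i.e., no entry equals +∞). Then Im A* = Im B* if and only if A* = B*. -/
noncomputable section

open scoped Classical

/-- Max-plus matrix-vector product: `(A ⊗ x)_i = sup_j (A_{ij} + x_j)`. -/
def mpMulVec {N P : Type*} (A : N → P → EReal) (x : P → EReal) : N → EReal :=
  fun i => ⨆ j, A i j + x j

/-- Max-plus matrix-matrix product. -/
def mpMulMat {N P Q : Type*} (A : N → P → EReal) (B : P → Q → EReal) : N → Q → EReal :=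
  fun i j => ⨆ k, A i k + B k j

/-- Max-plus identity matrix `E`. -/
def mpId {N : Type*} [DecidableEq N] : N → N → EReal :=
  fun i j => if i = j then (0 : EReal) else ⊥

/-- Max-plus matrix powers: `A^0 = E`, `A^{k+1} = A^k ⊗ A`. -/
def mpPow {N : Type*} [DecidableEq N] (A : N → N → EReal) : ℕ → N → N → EReal
  | 0 => mpId
  | k + 1 => mpMulMat (mpPow A k) A

/-- Kleene star `A* = sup_{k ≥ 0} A^k` (entrywise supremum). -/
def mpStar {N : Type*} [DecidableEq N] (A : N → N → EReal) : N → N → EReal :=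
  fun i j => ⨆ k : ℕ, mpPow A k i j

/-- Image of a matrix: `Im U = { U ⊗ u : u ∈ ℝ_max^P } ⊆ ℝ_max^N`. -/
def mpIm {N P : Type*} (U : N → P → EReal) : Set (N → EReal) :=
  { x | (∀ i, x i ≠ ⊤) ∧ ∃ u : P → EReal, (∀ j, u j ≠ ⊤) ∧ x = mpMulVec U u }

/-- Existence of a positive-weight circuit in the precedence graph `G(A)`. -/
def hasPosCircuit {N : Type*} (A : N → N → EReal) : Prop :=
  ∃ (l : ℕ) (p : ℕ → N), p l = p 0 ∧ (∀ t < l, A (p (t + 1)) (p t) ≠ ⊥) ∧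
    0 < ∑ t ∈ Finset.range l, A (p (t + 1)) (p t)

/-- The block-tridiagonal matrix `M_[K]` with diagonal blocks `C`,
superdiagonal blocks `L`, subdiagonal blocks `R`. -/
def MK {n : ℕ} (L C R : Fin n → Fin n → EReal) (K : ℕ) :
    Fin K × Fin n → Fin K × Fin n → EReal :=
  fun p q =>
    if p.1.val = q.1.val then C p.2 q.2
    else if p.1.val + 1 = q.1.val then L p.2 q.2
    else if q.1.val + 1 = p.1.val then R p.2 q.2
    else ⊥

/-- The infinite block-tridiagonal matrix `M_[∞]`, indexed by `ℕ × Fin n`. -/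
def Minf {n : ℕ} (L C R : Fin n → Fin n → EReal) :
    ℕ × Fin n → ℕ × Fin n → EReal :=
  fun p q =>
    if p.1 = q.1 then C p.2 q.2
    else if p.1 + 1 = q.1 then L p.2 q.2
    else if q.1 + 1 = p.1 then R p.2 q.2
    else ⊥

/-- Existence of a finite real trajectory `x : {1,…,K} → ℝ^n` satisfying
`x(k) ≥ C ⊗ x(k)`, `x(k) ≥ L ⊗ x(k+1)` and `x(k+1) ≥ R ⊗ x(k)`. -/
def FiniteTraj {n : ℕ} (L C R : Fin n → Fin n → EReal) (K : ℕ) : Prop :=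
  ∃ x : Fin K → Fin n → ℝ,
    (∀ k : Fin K, ∀ i, mpMulVec C (fun j => (x k j : EReal)) i ≤ (x k i : EReal)) ∧
    (∀ k : Fin K, ∀ h : k.val + 1 < K, ∀ i,
      mpMulVec L (fun j => (x ⟨k.val + 1, h⟩ j : EReal)) i ≤ (x k i : EReal) ∧
      mpMulVec R (fun j => (x k j : EReal)) i ≤ (x ⟨k.val + 1, h⟩ i : EReal))

/-- Weak consistency of system (8). -/
def WeaklyConsistent {n : ℕ} (L C R : Fin n → Fin n → EReal) : Prop :=
  ∀ K : ℕ, FiniteTraj L C R K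

/-- Consistency of system (8): existence of an infinite real trajectory. -/
def Consistent {n : ℕ} (L C R : Fin n → Fin n → EReal) : Prop :=
  ∃ x : ℕ → Fin n → ℝ, ∀ k : ℕ,
    (∀ i, mpMulVec L (fun j => (x (k + 1) j : EReal)) i ≤ (x k i : EReal)) ∧
    (∀ i, mpMulVec C (fun j => (x k j : EReal)) i ≤ (x k i : EReal)) ∧
    (∀ i, mpMulVec R (fun j => (x k j : EReal)) i ≤ (x (k + 1) i : EReal))

/-- The sequence `Π_0 = C*`, `Π_{k+1} = (L ⊗ Π_k ⊗ R ⊕ C)*`. -/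
def PiSeq {n : ℕ} (L C R : Fin n → Fin n → EReal) : ℕ → Fin n → Fin n → EReal
  | 0 => mpStar C
  | k + 1 => mpStar (fun i j => max (mpMulMat (mpMulMat L (PiSeq L C R k)) R i j) (C i j))

/-- Lifted matrix `Ā = [[ε, E], [ε, ε]]`. -/
def Abar (n : ℕ) : Fin n ⊕ Fin n → Fin n ⊕ Fin n → EReal :=
  fun p q =>
    match p, q with
    | Sum.inl i, Sum.inr j => mpId i j
    | _, _ => ⊥

/-- Lifted matrix `B̄ = [ε; E]`. -/
def Bbar (n : ℕ) : Fin n ⊕ Fin n → Fin n → EReal :=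
  fun p j =>
    match p with
    | Sum.inl _ => ⊥
    | Sum.inr i => mpId i j

/-- Lifted matrix `H = [[C, L], [R, C]]`. -/
def Hmat {n : ℕ} (L C R : Fin n → Fin n → EReal) :
    Fin n ⊕ Fin n → Fin n ⊕ Fin n → EReal :=
  fun p q =>
    match p, q with
    | Sum.inl i, Sum.inl j => C i j
    | Sum.inl i, Sum.inr j => L i j
    | Sum.inr i, Sum.inl j => R i j
    | Sum.inr i, Sum.inr j => C i j

/-- The semimodule `K = Im H*`. -/
def Kset {n : ℕ} (L C R : Fin n → Fin n → EReal) : Set (Fin n ⊕ Fin n → EReal) :=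
  mpIm (mpStar (Hmat L C R))

/-- The map `φ(X) = X ∩ { x ∈ ℝ_max^N : ∃ u ∈ ℝ_max^M, A ⊗ x ⊕ B ⊗ u ∈ X }`. -/
def mpPhi {N M : Type*} (A : N → N → EReal) (B : N → M → EReal)
    (X : Set (N → EReal)) : Set (N → EReal) :=
  X ∩ { x | (∀ i, x i ≠ ⊤) ∧ ∃ u : M → EReal, (∀ j, u j ≠ ⊤) ∧
    (fun i => max (mpMulVec A x i) (mpMulVec B u i)) ∈ X }

/-- Controlled trajectory: `x(1) = x0`, `x(k+1) = A ⊗ x(k) ⊕ B ⊗ u(k)`. -/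
def mpTraj {N M : Type*} (A : N → N → EReal) (B : N → M → EReal)
    (x0 : N → EReal) (u : ℕ → M → EReal) : ℕ → N → EReal
  | 0 => x0
  | k + 1 => fun i => max (mpMulVec A (mpTraj A B x0 u k) i) (mpMulVec B (u k) i)

/-- `K^♯`: states of `K` from which some control keeps the whole trajectory in `K`. -/
def mpKsharp {N M : Type*} (A : N → N → EReal) (B : N → M → EReal)
    (K : Set (N → EReal)) : Set (N → EReal) :=
  { x | x ∈ K ∧ ∃ u : ℕ → M → EReal, (∀ k j, u k j ≠ ⊤) ∧
    ∀ k : ℕ, mpTraj A B x u k ∈ K }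

/-- Real vectors `ℝ^N` inside `ℝ̄^N`. -/
def RealVecs {N : Type*} : Set (N → EReal) := { x | ∀ i, x i ≠ ⊤ ∧ x i ≠ ⊥ }

/-- Semimodules of `ℝ_max^N`: closed under entrywise max and scalar addition. -/
def IsSemimodule {N : Type*} (X : Set (N → EReal)) : Prop :=
  (∀ x ∈ X, ∀ i, x i ≠ ⊤) ∧
  (∀ x ∈ X, ∀ y ∈ X, (fun i => max (x i) (y i)) ∈ X) ∧
  (∀ x ∈ X, ∀ lam : EReal, lam ≠ ⊤ → (fun i => lam + x i) ∈ X)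

/-- Embedding of the first two block indices into `Fin (k+2) × Fin n`. -/
def emb2 {n : ℕ} (k : ℕ) : Fin n ⊕ Fin n → Fin (k + 2) × Fin n
  | Sum.inl i => (⟨0, by omega⟩, i)
  | Sum.inr i => (⟨1, by omega⟩, i)

/-- `S_{k+2}`: top-left `2n × 2n` submatrix of `(M_[k+2])*`. -/
def Smat {n : ℕ} (L C R : Fin n → Fin n → EReal) (k : ℕ) :
    Fin n ⊕ Fin n → Fin n ⊕ Fin n → EReal :=
  fun p q => mpStar (MK L C R (k + 2)) (emb2 k p) (emb2 k q)

/-- Embedding of the first two block indices into `ℕ × Fin n`. -/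
def embInf {n : ℕ} : Fin n ⊕ Fin n → ℕ × Fin n
  | Sum.inl i => (0, i)
  | Sum.inr i => (1, i)

/-- `S_∞`: top-left `2n × 2n` submatrix of `(M_[∞])*`. -/
def Sinf {n : ℕ} (L C R : Fin n → Fin n → EReal) :
    Fin n ⊕ Fin n → Fin n ⊕ Fin n → EReal :=
  fun p q => mpStar (Minf L C R) (embInf p) (embInf q)

lemma EReal.iSup_add_iSup_le {ι κ : Sort*} {f : ι → EReal} {g : κ → EReal} {c : EReal}
    (h : ∀ i j, f i + g j ≤ c) : (⨆ i, f i) + ⨆ j, g j ≤ c := by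
  refine EReal.add_le_of_forall_lt fun a ha b hb => ?_
  obtain ⟨i, hi⟩ := lt_iSup_iff.1 ha
  obtain ⟨j, hj⟩ := lt_iSup_iff.1 hb
  exact (add_le_add hi.le hj.le).trans (h i j)

lemma EReal.add_iSup_le {ι : Sort*} {a : EReal} {f : ι → EReal} {c : EReal}
    (h : ∀ i, a + f i ≤ c) : a + ⨆ i, f i ≤ c := by
  simpa using EReal.iSup_add_iSup_le (f := fun _ : Unit => a) fun _ => h

section KleeneStar

variable {N : Type*} [DecidableEq N] (A : N → N → EReal)

lemma mpPow_add_mpPow_le (m l : ℕ) (i k j : N) :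
    mpPow A m i k + mpPow A l k j ≤ mpPow A (m + l) i j := by
  induction l generalizing j with
  | zero =>
    by_cases h : k = j
    · simp [mpPow, mpId, h]
    · simp [mpPow, mpId, h]
  | succ l ih =>
    refine EReal.add_iSup_le fun q => ?_
    rw [← add_assoc]
    exact (add_le_add_left (ih q) _).trans
      (le_iSup (fun q => mpPow A (m + l) i q + A q j) q)

lemma mpStar_add_mpStar_le (i k j : N) : mpStar A i k + mpStar A k j ≤ mpStar A i j :=
  EReal.iSup_add_iSup_le fun m l =>
    (mpPow_add_mpPow_le A m l i k j).trans (le_iSup (fun m => mpPow A m i j) (m + l))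

lemma zero_le_mpStar_self (i : N) : 0 ≤ mpStar A i i :=
  le_iSup_of_le 0 (by simp [mpPow, mpId])

variable {A}

lemma mpStar_add_le_of_mem_mpIm {x : N → EReal} (hx : x ∈ mpIm (mpStar A)) (i k : N) :
    mpStar A i k + x k ≤ x i := by
  obtain ⟨-, u, -, rfl⟩ := hx
  refine EReal.add_iSup_le fun l => ?_
  rw [← add_assoc]
  exact (add_le_add_left (mpStar_add_mpStar_le A i k l) _).trans
    (le_iSup (fun l => mpStar A i l + u l) l)

lemma col_mem_mpIm {M : Type*} {U : M → N → EReal} (hU : ∀ i j, U i j ≠ ⊤) (j : N) :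
    (fun i => U i j) ∈ mpIm U := by
  refine ⟨fun i => hU i j, fun k => if k = j then 0 else ⊥, fun k => ?_, funext fun i => ?_⟩
  · dsimp only
    split_ifs <;> simp
  · refine le_antisymm (le_iSup_of_le j (by simp)) (iSup_le fun k => ?_)
    by_cases h : k = j <;> simp [h]

lemma mpStar_le_of_mpIm_subset {B : N → N → EReal} (hB : ∀ i j, mpStar B i j ≠ ⊤)
    (h : mpIm (mpStar B) ⊆ mpIm (mpStar A)) : mpStar A ≤ mpStar B := fun i j =>
  calc mpStar A i j = mpStar A i j + 0 := (add_zero _).symm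
    _ ≤ mpStar A i j + mpStar B j j := add_le_add_right (zero_le_mpStar_self B j) _
    _ ≤ mpStar B i j := mpStar_add_le_of_mem_mpIm (h (col_mem_mpIm hB j)) i j

end KleeneStar

/-- If all entries of `A*` and `B*` lie in `ℝ_max`, then
`Im A* = Im B*` iff `A* = B*`. -/
theorem stmt_1 (n : ℕ) (hn : 0 < n) (A B : Fin n → Fin n → EReal)
    (hA : ∀ i j, A i j ≠ ⊤) (hB : ∀ i j, B i j ≠ ⊤)
    (hAs : ∀ i j, mpStar A i j ≠ ⊤) (hBs : ∀ i j, mpStar B i j ≠ ⊤) :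
    mpIm (mpStar A) = mpIm (mpStar B) ↔ mpStar A = mpStar B := by
  exact ⟨fun h => le_antisymm (mpStar_le_of_mpIm_subset hBs h.ge)
    (mpStar_le_of_mpIm_subset hAs h.le), fun h => h ▸ rfl⟩
end
end

section
/- Let n ∈ ℕ and L, C, R ∈ ℝ_max^{n×n}. The system (8) is weakly consistent if and only if the precedence graph G(M_[∞]) contains no positive-weight circuit. -/
noncomputable section

open scoped Classical

/-- If all circuits have nonpositive weight, then the weight of any walk in a finite graph is
bounded by that of a walk with at most `Fintype.card V` arcs. -/
lemma walk_weight_le {V : Type*} [Fintype V] {E : V → V → Prop} {w : V → V → ℝ} {M : ℝ}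
    (hM : 0 ≤ M) (hw : ∀ i j, w i j ≤ M)
    (hcirc : ∀ (l : ℕ) (p : ℕ → V), p l = p 0 → (∀ t < l, E (p (t + 1)) (p t)) →
      ∑ t ∈ Finset.range l, w (p (t + 1)) (p t) ≤ 0)
    (l : ℕ) (p : ℕ → V) (hp : ∀ t < l, E (p (t + 1)) (p t)) :
    ∑ t ∈ Finset.range l, w (p (t + 1)) (p t) ≤ Fintype.card V * M := by
  induction l using Nat.strong_induction_on generalizing p with
  | _ l ih =>
    rcases le_or_gt l (Fintype.card V) with hl | hl
    · calc ∑ t ∈ Finset.range l, w (p (t + 1)) (p t) ≤ ∑ _t ∈ Finset.range l, M :=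
            Finset.sum_le_sum fun t _ => hw _ _
        _ = l * M := by simp
        _ ≤ Fintype.card V * M := by gcongr
    · obtain ⟨i, j, hij, hjl, hpij⟩ : ∃ i j, i < j ∧ j ≤ l ∧ p i = p j := by
        obtain ⟨a, b, hab, h⟩ := Fintype.exists_ne_map_eq_of_card_lt
          (fun a : Fin (Fintype.card V + 1) => p a) (by simp)
        have ha := a.isLt
        have hb := b.isLt
        rcases lt_or_gt_of_ne (Fin.val_ne_of_ne hab) with h' | h'
        · exact ⟨a, b, h', by omega, h⟩
        · exact ⟨b, a, h', by omega, h.symm⟩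
      obtain ⟨d, rfl⟩ := Nat.exists_eq_add_of_lt hij
      obtain ⟨m, rfl⟩ := Nat.exists_eq_add_of_le hjl
      have hcycle := hcirc (d + 1) (fun t => p (i + t)) (by simpa [add_assoc] using hpij.symm)
        (fun t ht => hp (i + t) (by omega))
      let q : ℕ → V := fun t => if t ≤ i then p t else p (t + (d + 1))
      have hq_left : ∀ t ≤ i, q t = p t := fun t ht => if_pos ht
      have hq_right : ∀ t, q (i + t) = p (i + d + 1 + t) := by
        intro t
        rcases Nat.eq_zero_or_pos t with rfl | ht
        · simpa [q] using hpij
        · simp only [q]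
          rw [if_neg (by omega)]
          congr 1
          omega
      have hshort := ih (i + m) (by omega) q (by
        intro t ht
        rcases lt_or_ge t i with h | h
        · rw [hq_left _ h, hq_left _ h.le]
          exact hp t (by omega)
        · obtain ⟨s, rfl⟩ := Nat.exists_eq_add_of_le h
          rw [hq_right, add_assoc, hq_right]
          exact hp (i + d + 1 + s) (by omega))
      rw [Finset.sum_range_add] at hshort
      rw [Finset.sum_range_add, add_assoc i, Finset.sum_range_add]
      have hleft : ∑ t ∈ Finset.range i, w (q (t + 1)) (q t) =
          ∑ t ∈ Finset.range i, w (p (t + 1)) (p t) := by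
        refine Finset.sum_congr rfl fun t ht => ?_
        have := Finset.mem_range.mp ht
        rw [hq_left _ this, hq_left _ this.le]
      have hright : ∑ t ∈ Finset.range m, w (q (i + t + 1)) (q (i + t)) =
          ∑ t ∈ Finset.range m, w (p (i + (d + 1) + t + 1)) (p (i + (d + 1) + t)) := by
        refine Finset.sum_congr rfl fun t _ => ?_
        rw [add_assoc i t, hq_right, hq_right]
        rfl
      rw [hleft, hright] at hshort
      have hcycle' : ∑ t ∈ Finset.range (d + 1), w (p (i + t + 1)) (p (i + t)) ≤ 0 := hcycle
      linarith

/-- A finite weighted graph without positive-weight circuits admits a real potential. -/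
lemma exists_potential {V : Type*} [Fintype V] {E : V → V → Prop} {w : V → V → ℝ}
    (hcirc : ∀ (l : ℕ) (p : ℕ → V), p l = p 0 → (∀ t < l, E (p (t + 1)) (p t)) →
      ∑ t ∈ Finset.range l, w (p (t + 1)) (p t) ≤ 0) :
    ∃ x : V → ℝ, ∀ i j, E i j → w i j + x j ≤ x i := by
  obtain ⟨M, hM⟩ := (Set.finite_range fun v : V × V => w v.1 v.2).bddAbove
  have hw : ∀ i j, w i j ≤ max M 0 := fun i j =>
    (hM (Set.mem_range_self (i, j))).trans (le_max_left _ _)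
  let S : V → Set ℝ := fun v => {r | ∃ (l : ℕ) (p : ℕ → V), p l = v ∧
    (∀ t < l, E (p (t + 1)) (p t)) ∧ ∑ t ∈ Finset.range l, w (p (t + 1)) (p t) = r}
  have hbdd : ∀ v, BddAbove (S v) := by
    rintro v
    refine ⟨Fintype.card V * max M 0, ?_⟩
    rintro _ ⟨l, p, -, hp, rfl⟩
    exact walk_weight_le (le_max_right _ _) hw hcirc l p hp
  refine ⟨fun v => sSup (S v), fun i j hij => ?_⟩
  rw [← le_sub_iff_add_le']
  refine csSup_le ⟨0, 0, fun _ => j, rfl, by simp, by simp⟩ ?_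
  rintro _ ⟨l, p, hpl, hp, rfl⟩
  rw [le_sub_iff_add_le']
  refine le_csSup (hbdd i) ⟨l + 1, fun t => if t ≤ l then p t else i, by simp, ?_, ?_⟩
  · intro t ht
    rcases Nat.lt_succ_iff_lt_or_eq.mp ht with h | rfl
    · simpa [h.le, Nat.succ_le_of_lt h] using hp t h
    · simpa [hpl] using hij
  · rw [Finset.sum_range_succ, add_comm]
    congr 1
    · simp [hpl]
    · refine Finset.sum_congr rfl fun t ht => ?_
      have h := Finset.mem_range.mp ht
      simp [h.le, Nat.succ_le_of_lt h]

lemma sum_toReal {ι : Type*} (s : Finset ι) {f : ι → EReal} (hbot : ∀ i ∈ s, f i ≠ ⊥)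
    (htop : ∀ i ∈ s, f i ≠ ⊤) : ∑ i ∈ s, f i = ((∑ i ∈ s, (f i).toReal : ℝ) : EReal) := by
  induction s using Finset.cons_induction with
  | empty => simp
  | cons a s ha ih =>
    rw [Finset.forall_mem_cons] at hbot htop
    rw [Finset.sum_cons, Finset.sum_cons, EReal.coe_add, EReal.coe_toReal htop.1 hbot.1,
      ih hbot.2 htop.2]

lemma circuit_weight_nonpos {N : Type*} {A : N → N → EReal} {l : ℕ} {p : ℕ → N}
    (x : N → ℝ) (hA : ∀ t < l, A (p (t + 1)) (p t) + x (p t) ≤ x (p (t + 1)))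
    (hcirc : p l = p 0) (hbot : ∀ t < l, A (p (t + 1)) (p t) ≠ ⊥)
    (htop : ∀ t < l, A (p (t + 1)) (p t) ≠ ⊤) :
    ∑ t ∈ Finset.range l, A (p (t + 1)) (p t) ≤ 0 := by
  rw [sum_toReal _ (fun t ht => hbot t (Finset.mem_range.mp ht))
    (fun t ht => htop t (Finset.mem_range.mp ht)), ← EReal.coe_zero, EReal.coe_le_coe_iff]
  calc ∑ t ∈ Finset.range l, (A (p (t + 1)) (p t)).toReal
      ≤ ∑ t ∈ Finset.range l, (x (p (t + 1)) - x (p t)) := by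
        refine Finset.sum_le_sum fun t ht => ?_
        have ht := Finset.mem_range.mp ht
        have h := hA t ht
        rw [← EReal.coe_toReal (htop t ht) (hbot t ht), ← EReal.coe_add,
          EReal.coe_le_coe_iff] at h
        linarith
    _ = 0 := by rw [Finset.sum_range_sub (fun t => x (p t)), hcirc, sub_self]

lemma finiteTraj_iff {n : ℕ} (L C R : Fin n → Fin n → EReal) (K : ℕ) :
    FiniteTraj L C R K ↔ ∃ x : Fin K × Fin n → ℝ, ∀ u v, MK L C R K u v + x v ≤ x u := by
  constructor
  · rintro ⟨x, hC, hLR⟩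
    refine ⟨fun u => x u.1 u.2, ?_⟩
    rintro ⟨⟨k, hk⟩, i⟩ ⟨⟨m, hm⟩, j⟩
    simp only [MK]
    split_ifs with h₁ h₂ h₃
    · subst h₁
      exact iSup_le_iff.mp (hC ⟨k, hk⟩ i) j
    · subst h₂
      exact iSup_le_iff.mp (hLR ⟨k, hk⟩ hm i).1 j
    · subst h₃
      exact iSup_le_iff.mp (hLR ⟨m, hm⟩ hk i).2 j
    · simp
  · rintro ⟨x, hx⟩
    refine ⟨fun k i => x (k, i), fun k i => iSup_le fun j => ?_,
      fun k h i => ⟨iSup_le fun j => ?_, iSup_le fun j => ?_⟩⟩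
    · simpa [MK] using hx (k, i) (k, j)
    · simpa [MK] using hx (k, i) (⟨k + 1, h⟩, j)
    · simpa [MK, show k.val + 1 + 1 ≠ k.val by omega] using hx (⟨k + 1, h⟩, i) (k, j)

lemma Minf_ne_top {n : ℕ} {L C R : Fin n → Fin n → EReal} (hL : ∀ i j, L i j ≠ ⊤)
    (hC : ∀ i j, C i j ≠ ⊤) (hR : ∀ i j, R i j ≠ ⊤) (u v : ℕ × Fin n) :
    Minf L C R u v ≠ ⊤ := by
  unfold Minf
  split_ifs
  exacts [hC _ _, hL _ _, hR _ _, bot_ne_top]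

/-- system (8) is weakly consistent iff `G(M_[∞])` contains no
positive-weight circuit. -/
theorem stmt_7 (n : ℕ) (hn : 0 < n) (L C R : Fin n → Fin n → EReal)
    (hL : ∀ i j, L i j ≠ ⊤) (hC : ∀ i j, C i j ≠ ⊤) (hR : ∀ i j, R i j ≠ ⊤) :
    WeaklyConsistent L C R ↔ ¬ hasPosCircuit (Minf L C R) := by
  constructor
  · rintro hwc ⟨l, p, hp, hbot, hpos⟩
    obtain ⟨B, hB⟩ := ((Finset.range (l + 1)).image fun t => (p t).1).bddAbove
    have hlt : ∀ t ≤ l, (p t).1 < B + 1 := fun t ht =>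
      Nat.lt_succ_of_le (hB (Finset.mem_image_of_mem _ (Finset.mem_range.mpr (by omega))))
    obtain ⟨x, hx⟩ := (finiteTraj_iff L C R (B + 1)).mp (hwc (B + 1))
    let y : ℕ × Fin n → ℝ := fun u => if h : u.1 < B + 1 then x (⟨u.1, h⟩, u.2) else 0
    refine hpos.not_ge (circuit_weight_nonpos y (fun t ht => ?_) hp hbot
      fun t _ => Minf_ne_top hL hC hR _ _)
    simp only [y, dif_pos (hlt (t + 1) ht), dif_pos (hlt t ht.le)]
    exact hx (⟨(p (t + 1)).1, hlt (t + 1) ht⟩, _) (⟨(p t).1, hlt t ht.le⟩, _)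
  · intro hno K
    rw [finiteTraj_iff]
    have htop : ∀ u v, MK L C R K u v ≠ ⊤ := fun u v =>
      Minf_ne_top hL hC hR (u.1.val, u.2) (v.1.val, v.2)
    obtain ⟨x, hx⟩ := exists_potential (E := fun u v => MK L C R K u v ≠ ⊥)
      (w := fun u v => (MK L C R K u v).toReal) (by
        intro l p hp hE
        by_contra! hpos
        refine hno ⟨l, fun t => ((p t).1.val, (p t).2), by simp only [hp], hE, ?_⟩
        change 0 < ∑ t ∈ Finset.range l, MK L C R K (p (t + 1)) (p t)
        rw [sum_toReal _ (fun t ht => hE t (Finset.mem_range.mp ht)) fun _ _ => htop _ _]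
        exact_mod_cast hpos)
    refine ⟨x, fun u v => ?_⟩
    by_cases h : MK L C R K u v = ⊥
    · simp [h]
    · rw [← EReal.coe_toReal (htop u v) h]
      exact_mod_cast hx u v h
end
end

section
/- Let n ∈ ℕ and L, C, R ∈ ℝ_max^{n×n}. The system (8) is consistent if and only if Π_{n²+1} = Π_{n²} and every entry of Π_{n²} lies in ℝ_max (i.e., no entry of Π_{n²} equals +∞). -/
noncomputable section

open scoped Classical

/-- The matrix `L ⊗ X ⊗ R ⊕ C`, whose star is the successor of `X` in the sequence `PiSeq`. -/
def excMat {n : ℕ} (L C R X : Fin n → Fin n → EReal) : Fin n → Fin n → EReal :=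
  fun i j => max (mpMulMat (mpMulMat L X) R i j) (C i j)

section General

variable {N : Type*} [DecidableEq N]

theorem mpMulMat_mono {M P Q : Type*} {A A' : M → P → EReal} {B B' : P → Q → EReal}
    (hA : A ≤ A') (hB : B ≤ B') : mpMulMat A B ≤ mpMulMat A' B' :=
  fun i j => iSup_mono fun k => add_le_add (hA i k) (hB k j)

theorem le_mpMulMat {M P Q : Type*} (A : M → P → EReal) (B : P → Q → EReal) (i : M) (k : P)
    (j : Q) : A i k + B k j ≤ mpMulMat A B i j :=
  le_iSup (fun k => A i k + B k j) k

theorem exists_mpMulMat_eq {M P Q : Type*} [Finite P] [Nonempty P] (A : M → P → EReal)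
    (B : P → Q → EReal) (i : M) (j : Q) : ∃ k, mpMulMat A B i j = A i k + B k j := by
  obtain ⟨k, hk⟩ := exists_eq_ciSup_of_finite (f := fun k => A i k + B k j)
  exact ⟨k, hk.symm⟩

theorem mpPow_mono {A B : N → N → EReal} (h : A ≤ B) (t : ℕ) : mpPow A t ≤ mpPow B t := by
  induction t with
  | zero => exact le_rfl
  | succ t ih => exact mpMulMat_mono ih h

theorem mpStar_mono {A B : N → N → EReal} (h : A ≤ B) : mpStar A ≤ mpStar B :=
  fun i j => iSup_mono fun t => mpPow_mono h t i j

theorem mpPow_le_mpStar (A : N → N → EReal) (t : ℕ) : mpPow A t ≤ mpStar A :=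
  fun i j => le_iSup (fun t => mpPow A t i j) t

theorem zero_le_mpStar (A : N → N → EReal) (i : N) : 0 ≤ mpStar A i i := by
  have h := mpPow_le_mpStar A 0 i i
  simpa [mpPow, mpId] using h

theorem le_mpStar (A : N → N → EReal) : A ≤ mpStar A := by
  intro i j
  refine le_trans ?_ (mpPow_le_mpStar A 1 i j)
  have h := le_mpMulMat (mpId : N → N → EReal) A i i j
  simpa [mpPow, mpId] using h

/-- A reflexive and transitive matrix dominating `A` dominates the star of `A`. -/
theorem mpStar_le {A P : N → N → EReal} (hrefl : ∀ i, 0 ≤ P i i)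
    (htrans : ∀ i k j, P i k + P k j ≤ P i j) (h : A ≤ P) : mpStar A ≤ P := by
  intro i j
  refine iSup_le fun t => ?_
  induction t generalizing j with
  | zero =>
    by_cases hij : i = j
    · subst hij
      simpa [mpPow, mpId] using hrefl i
    · simp [mpPow, mpId, hij]
  | succ t ih => exact iSup_le fun k => (add_le_add (ih k) (h k j)).trans (htrans i k j)

theorem mpPow_add_le [Finite N] [Nonempty N] (A : N → N → EReal) (s t : ℕ) (i k j : N) :
    mpPow A s i k + mpPow A t k j ≤ mpPow A (s + t) i j := by
  induction t generalizing j with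
  | zero =>
    by_cases hkj : k = j
    · subst hkj
      simp [mpPow, mpId]
    · simp [mpPow, mpId, hkj]
  | succ t ih =>
    obtain ⟨l, hl⟩ := exists_mpMulMat_eq (mpPow A t) A k j
    calc mpPow A s i k + mpPow A (t + 1) k j
        = mpPow A s i k + mpPow A t k l + A l j := by rw [add_assoc, ← hl]; rfl
      _ ≤ mpPow A (s + t) i l + A l j := add_le_add_left (ih l) _
      _ ≤ mpPow A (s + (t + 1)) i j := le_mpMulMat (mpPow A (s + t)) A i l j

theorem mpStar_trans [Finite N] [Nonempty N] (A : N → N → EReal) (i k j : N) :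
    mpStar A i k + mpStar A k j ≤ mpStar A i j := by
  refine EReal.add_le_of_forall_lt fun a ha b hb => ?_
  obtain ⟨s, hs⟩ := lt_iSup_iff.1 ha
  obtain ⟨t, ht⟩ := lt_iSup_iff.1 hb
  exact (add_le_add hs.le ht.le).trans
    ((mpPow_add_le A s t i k j).trans (mpPow_le_mpStar A (s + t) i j))

/-- Applying a star without infinite entries to a real vector gives a real vector in its image. -/
theorem exists_real_mpStar_closure [Finite N] [Nonempty N] {A : N → N → EReal}
    (hA : ∀ i j, mpStar A i j ≠ ⊤) (w : N → ℝ) :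
    ∃ y : N → ℝ, (∀ i, w i ≤ y i) ∧ (∀ i j, mpStar A i j + (y j : EReal) ≤ y i) ∧
      ∀ i, ∃ b, (y i : EReal) = mpStar A i b + w b := by
  have hatt : ∀ i, ∃ b, ∀ j, mpStar A i j + (w j : EReal) ≤ mpStar A i b + w b := fun i =>
    Finite.exists_max fun j => mpStar A i j + (w j : EReal)
  choose b hb using hatt
  have hw : ∀ i, (w i : EReal) ≤ mpStar A i (b i) + w (b i) := fun i => by
    refine le_trans ?_ (hb i i)
    simpa using add_le_add_left (zero_le_mpStar A i) (w i : EReal)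
  have hreal : ∀ i, ∃ y : ℝ, (y : EReal) = mpStar A i (b i) + w (b i) := fun i => by
    refine ⟨_, EReal.coe_toReal ?_ ?_⟩
    · exact EReal.add_ne_top (hA _ _) (EReal.coe_ne_top _)
    · exact ((EReal.bot_lt_coe _).trans_le (hw i)).ne'
  choose y hy using hreal
  refine ⟨y, fun i => ?_, fun i j => ?_, fun i => ⟨b i, hy i⟩⟩
  · exact_mod_cast (hw i).trans_eq (hy i).symm
  · rw [hy i, hy j, ← add_assoc]
    exact (add_le_add_left (mpStar_trans A i j (b j)) _).trans (hb i (b j))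

end General

section Excursions

variable {n : ℕ} {L C R : Fin n → Fin n → EReal}

theorem excMat_mono {X Y : Fin n → Fin n → EReal} (h : X ≤ Y) :
    excMat L C R X ≤ excMat L C R Y := fun i j =>
  max_le_max (mpMulMat_mono (mpMulMat_mono le_rfl h) le_rfl i j) le_rfl

theorem le_excMat (X : Fin n → Fin n → EReal) (i a b j : Fin n) :
    L i a + X a b + R b j ≤ excMat L C R X i j :=
  ((add_le_add_left (le_mpMulMat L X i a b) _).trans
    (le_mpMulMat (mpMulMat L X) R i b j)).trans (le_max_left _ _)

theorem PiSeq_succ (k : ℕ) :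
    PiSeq L C R (k + 1) = mpStar (excMat L C R (PiSeq L C R k)) := rfl

theorem PiSeq_mono : Monotone (PiSeq L C R) := by
  refine monotone_nat_of_le_succ fun k => ?_
  induction k with
  | zero => exact mpStar_mono fun i j => le_max_right _ _
  | succ k ih => exact mpStar_mono (excMat_mono ih)

theorem PiSeq_le_of_mpStar_excMat_le {P : Fin n → Fin n → EReal}
    (hP : mpStar (excMat L C R P) ≤ P) (k : ℕ) : PiSeq L C R k ≤ P := by
  induction k with
  | zero => exact (mpStar_mono fun i j => le_max_right _ _).trans hP
  | succ k ih => exact (mpStar_mono (excMat_mono ih)).trans hP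

/-- An entry of `L ⊗ Y ⊗ R ⊕ C` either does not grow when passing from `X` to `Y`, or is
`c + Y a b` for some entry of `Y` that is larger than the one of `X`. -/
theorem excMat_le_or_exists [Nonempty (Fin n)] (X Y P : Fin n → Fin n → EReal) (i j : Fin n) :
    excMat L C R Y i j ≤ excMat L C R X i j ∨
      ∃ (a b : Fin n) (c : EReal), X a b < Y a b ∧ excMat L C R Y i j ≤ c + Y a b ∧
        c + P a b ≤ excMat L C R P i j := by
  obtain ⟨b, hb⟩ := exists_mpMulMat_eq (mpMulMat L Y) R i j
  obtain ⟨a, ha⟩ := exists_mpMulMat_eq L Y i b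
  rcases le_total (mpMulMat (mpMulMat L Y) R i j) (C i j) with h | h
  · exact Or.inl (max_le (h.trans (le_max_right _ _)) (le_max_right _ _))
  have hY : excMat L C R Y i j = L i a + Y a b + R b j := by
    rw [← ha, ← hb]
    exact max_eq_left h
  rcases le_or_gt (Y a b) (X a b) with hab | hab
  · left
    rw [hY]
    exact (add_le_add_left (add_le_add_right hab _) _).trans (le_excMat X i a b j)
  · refine Or.inr ⟨a, b, L i a + R b j, hab, ?_, ?_⟩
    · rw [hY, add_right_comm]
    · rw [add_right_comm]
      exact le_excMat P i a b j

theorem mpPow_excMat_le_or_exists [Nonempty (Fin n)] {X Y P : Fin n → Fin n → EReal}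
    (hYP : Y ≤ P) (t : ℕ) (i j : Fin n) :
    mpPow (excMat L C R Y) t i j ≤ mpPow (excMat L C R X) t i j ∨
      ∃ (a b : Fin n) (c : EReal), X a b < Y a b ∧ mpPow (excMat L C R Y) t i j ≤ c + Y a b ∧
        c + P a b ≤ mpPow (excMat L C R P) t i j := by
  induction t generalizing j with
  | zero => exact Or.inl le_rfl
  | succ t ih =>
    obtain ⟨k, hk⟩ := exists_mpMulMat_eq (mpPow (excMat L C R Y) t) (excMat L C R Y) i j
    change mpPow (excMat L C R Y) (t + 1) i j = _ at hk
    have hle : ∀ Z, mpPow (excMat L C R Z) t i k + excMat L C R Z k j ≤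
        mpPow (excMat L C R Z) (t + 1) i j := fun Z => le_mpMulMat _ _ i k j
    rw [hk]
    rcases ih k with h₁ | ⟨a, b, c, hab, hY, hP⟩
    · rcases excMat_le_or_exists (L := L) (C := C) (R := R) X Y P k j with
        h₂ | ⟨a, b, c, hab, hY, hP⟩
      · exact Or.inl ((add_le_add h₁ h₂).trans (hle X))
      · refine Or.inr ⟨a, b, mpPow (excMat L C R Y) t i k + c, hab, ?_, ?_⟩
        · rw [add_assoc]
          exact add_le_add_right hY _
        · rw [add_assoc]
          exact (add_le_add (mpPow_mono (excMat_mono hYP) t i k) hP).trans (hle P)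
    · refine Or.inr ⟨a, b, c + excMat L C R Y k j, hab, ?_, ?_⟩
      · rw [add_right_comm]
        exact add_le_add_left hY _
      · rw [add_right_comm]
        exact (add_le_add hP (excMat_mono hYP k j)).trans (hle P)

/-- If the entry `p` of `PiSeq` exceeds a level `s` for the first time at step `k + 2`, then some
entry `q` exceeds a level `s'` for the first time at step `k + 1`, and the gap between level and
upper bound `P` does not get larger. -/
theorem exists_PiSeq_crossing [Nonempty (Fin n)] {P : Fin n → Fin n → EReal}
    (hP : mpStar (excMat L C R P) ≤ P) (hPtop : ∀ i j, P i j ≠ ⊤) {k : ℕ} {p : Fin n × Fin n}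
    {s : ℝ} (hs : PiSeq L C R (k + 1) p.1 p.2 ≤ s) (hs' : s < PiSeq L C R (k + 2) p.1 p.2) :
    ∃ (q : Fin n × Fin n) (s' : ℝ), PiSeq L C R k q.1 q.2 ≤ s' ∧
      s' < PiSeq L C R (k + 1) q.1 q.2 ∧
      s + (P q.1 q.2).toReal ≤ s' + (P p.1 p.2).toReal := by
  have hle := PiSeq_le_of_mpStar_excMat_le hP
  obtain ⟨t, ht⟩ := lt_iSup_iff.1 hs'
  rcases mpPow_excMat_le_or_exists (L := L) (C := C) (R := R) (X := PiSeq L C R k)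
    (hle (k + 1)) t p.1 p.2 with h | ⟨a, b, c, hab, hY, hcP⟩
  · exact absurd (ht.trans_le (h.trans (mpPow_le_mpStar _ t p.1 p.2))) hs.not_gt
  have hcP' : c + P a b ≤ P p.1 p.2 :=
    hcP.trans ((mpPow_le_mpStar _ t p.1 p.2).trans (hP p.1 p.2))
  have hsc : (s : EReal) < c + PiSeq L C R (k + 1) a b := lt_of_lt_of_le ht hY
  have hPab : P a b ≠ ⊥ := ((bot_le.trans_lt hab).trans_le (hle (k + 1) a b)).ne'
  have hPp : P p.1 p.2 ≠ ⊥ :=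
    (((EReal.bot_lt_coe s).trans hs').trans_le (hle (k + 2) p.1 p.2)).ne'
  have hcbot : c ≠ ⊥ := by
    rintro rfl
    simp at hsc
  have hctop : c ≠ ⊤ := by
    rintro rfl
    rw [EReal.top_add_of_ne_bot hPab] at hcP'
    exact hPtop _ _ (top_le_iff.1 hcP')
  have hYtop : PiSeq L C R (k + 1) a b ≠ ⊤ := ne_top_of_le_ne_top (hPtop a b) (hle (k + 1) a b)
  have hXtop : PiSeq L C R k a b ≠ ⊤ := hab.ne_top
  have hYbot : PiSeq L C R (k + 1) a b ≠ ⊥ := (bot_le.trans_lt hab).ne'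
  lift c to ℝ using ⟨hctop, hcbot⟩
  obtain ⟨y, hy⟩ : ∃ y : ℝ, (y : EReal) = PiSeq L C R (k + 1) a b :=
    ⟨_, EReal.coe_toReal hYtop hYbot⟩
  obtain ⟨u, hu⟩ : ∃ u : ℝ, (u : EReal) = P a b := ⟨_, EReal.coe_toReal (hPtop a b) hPab⟩
  obtain ⟨v, hv⟩ : ∃ v : ℝ, (v : EReal) = P p.1 p.2 := ⟨_, EReal.coe_toReal (hPtop _ _) hPp⟩
  rw [← hy] at hsc hab
  rw [← hu, ← hv] at hcP'
  have hsc' : s < c + y := by exact_mod_cast hsc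
  have hcuv : c + u ≤ v := by exact_mod_cast hcP'
  obtain ⟨s', hs'₁, hs'₂, hs'₃⟩ : ∃ s' : ℝ, PiSeq L C R k a b ≤ s' ∧ s' < y ∧ s ≤ c + s' := by
    rcases le_total (PiSeq L C R k a b) ((s - c : ℝ) : EReal) with h | h
    · exact ⟨s - c, h, by linarith, by linarith⟩
    · have hXbot : PiSeq L C R k a b ≠ ⊥ := ((EReal.bot_lt_coe _).trans_le h).ne'
      generalize PiSeq L C R k a b = z at *
      lift z to ℝ using ⟨hXtop, hXbot⟩
      have h' : s - c ≤ z := by exact_mod_cast h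
      exact ⟨z, le_rfl, by exact_mod_cast hab, by linarith⟩
  refine ⟨(a, b), s', hs'₁, ?_, ?_⟩
  · rw [← hy]
    exact_mod_cast hs'₂
  · rw [← hu, ← hv, EReal.toReal_coe, EReal.toReal_coe]
    linarith

/-- A crossing at step `k + 1` produces `k + 1` distinct entries with a crossing. -/
theorem exists_finset_crossings [Nonempty (Fin n)] {P : Fin n → Fin n → EReal}
    (hP : mpStar (excMat L C R P) ≤ P) (hPtop : ∀ i j, P i j ≠ ⊤) (k : ℕ) (p : Fin n × Fin n)
    (s : ℝ) (hs : PiSeq L C R k p.1 p.2 ≤ s) (hs' : s < PiSeq L C R (k + 1) p.1 p.2) :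
    ∃ T : Finset (Fin n × Fin n), T.card = k + 1 ∧ ∀ q ∈ T, ∃ l ≤ k, ∃ s' : ℝ,
      s' < PiSeq L C R (l + 1) q.1 q.2 ∧
      s + (P q.1 q.2).toReal ≤ s' + (P p.1 p.2).toReal := by
  induction k generalizing p s with
  | zero =>
    refine ⟨{p}, by simp, fun q hq => ?_⟩
    obtain rfl := Finset.mem_singleton.1 hq
    exact ⟨0, le_rfl, s, hs', le_rfl⟩
  | succ k ih =>
    obtain ⟨q, s₁, hq, hq', hle⟩ := exists_PiSeq_crossing hP hPtop hs hs'
    obtain ⟨T, hT, hTq⟩ := ih q s₁ hq hq'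
    have hp : p ∉ T := fun hpT => by
      obtain ⟨l, hl, s₂, hs₂, hle₂⟩ := hTq p hpT
      have h : (s₂ : EReal) < s :=
        hs₂.trans_le ((PiSeq_mono (Nat.succ_le_succ hl) p.1 p.2).trans hs)
      have h' : s₂ < s := by exact_mod_cast h
      linarith
    refine ⟨insert p T, by rw [Finset.card_insert_of_notMem hp, hT], fun r hr => ?_⟩
    rcases Finset.mem_insert.1 hr with rfl | hr
    · exact ⟨k + 1, le_rfl, s, hs', le_rfl⟩
    · obtain ⟨l, hl, s₂, hs₂, hle₂⟩ := hTq r hr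
      exact ⟨l, hl.trans k.le_succ, s₂, hs₂, by linarith⟩

/-- An upper bound without infinite entries forces `PiSeq` to be stationary after `n ^ 2` steps. -/
theorem PiSeq_eq_of_mpStar_excMat_le [Nonempty (Fin n)] {P : Fin n → Fin n → EReal}
    (hP : mpStar (excMat L C R P) ≤ P) (hPtop : ∀ i j, P i j ≠ ⊤) :
    PiSeq L C R (n ^ 2 + 1) = PiSeq L C R (n ^ 2) := by
  refine le_antisymm (fun i j => ?_) (PiSeq_mono (Nat.le_succ _))
  by_contra! h
  obtain ⟨s, hs, hs'⟩ : ∃ s : ℝ, PiSeq L C R (n ^ 2) i j ≤ s ∧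
      s < PiSeq L C R (n ^ 2 + 1) i j := by
    obtain ⟨s, h₁, h₂⟩ := EReal.lt_iff_exists_real_btwn.1 h
    exact ⟨s, h₁.le, h₂⟩
  obtain ⟨T, hT, -⟩ := exists_finset_crossings hP hPtop (n ^ 2) (i, j) s hs hs'
  have hcard := T.card_le_univ
  rw [hT, Fintype.card_prod, Fintype.card_fin, ← sq] at hcard
  omega

/-- The entries of a max-plus inequality `A ⊗ x ≤ y` between real vectors. -/
theorem le_sub_of_mpMulVec_le {N P : Type*} {A : N → P → EReal} {x : P → ℝ} {y : N → ℝ} {i : N}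
    (h : mpMulVec A (fun j => (x j : EReal)) i ≤ y i) (j : P) :
    A i j ≤ ((y i - x j : ℝ) : EReal) := by
  have h' : A i j + (x j : EReal) ≤ y i := (le_iSup (fun j => A i j + (x j : EReal)) j).trans h
  rw [EReal.coe_sub]
  exact EReal.le_sub_iff_add_le (Or.inl (EReal.coe_ne_bot _)) (Or.inl (EReal.coe_ne_top _)) |>.2 h'

theorem Consistent.exists_mpStar_excMat_le (h : Consistent L C R) :
    ∃ P : Fin n → Fin n → EReal, mpStar (excMat L C R P) ≤ P ∧ ∀ i j, P i j ≠ ⊤ := by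
  obtain ⟨x, hx⟩ := h
  refine ⟨fun i j => ⨅ m, ((x m i - x m j : ℝ) : EReal), mpStar_le (fun i => ?_)
    (fun i k j => ?_) (fun i j => ?_), fun i j => ?_⟩
  · simp
  · refine le_iInf fun m => (add_le_add (iInf_le _ m) (iInf_le _ m)).trans ?_
    rw [← EReal.coe_add, sub_add_sub_cancel]
  · refine le_iInf fun m => max_le ?_ (le_sub_of_mpMulVec_le ((hx m).2.1 i) j)
    have hn : Nonempty (Fin n) := ⟨i⟩
    obtain ⟨b, hb⟩ := exists_mpMulMat_eq
      (mpMulMat L (fun i j => ⨅ m, ((x m i - x m j : ℝ) : EReal))) R i j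
    obtain ⟨a, ha⟩ := exists_mpMulMat_eq L (fun i j => ⨅ m, ((x m i - x m j : ℝ) : EReal)) i b
    rw [hb, ha]
    refine (add_le_add (add_le_add (le_sub_of_mpMulVec_le ((hx m).1 i) a) (iInf_le _ (m + 1)))
      (le_sub_of_mpMulVec_le ((hx m).2.2 b) j)).trans ?_
    rw [← EReal.coe_add, ← EReal.coe_add]
    exact EReal.coe_le_coe_iff.2 (by linarith)
  · exact ne_top_of_le_ne_top (EReal.coe_ne_top _) (iInf_le _ 0)

/-- If `Q = (L ⊗ Q ⊗ R ⊕ C)*` has no infinite entry, a real vector closed under `Q` is the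
initial segment of a trajectory and can be extended by another vector closed under `Q`. -/
theorem exists_next_of_eq_mpStar [Nonempty (Fin n)] {Q : Fin n → Fin n → EReal}
    (hQ : Q = mpStar (excMat L C R Q)) (hQtop : ∀ i j, Q i j ≠ ⊤)
    (hL : ∀ i j, L i j ≠ ⊤) (hR : ∀ i j, R i j ≠ ⊤) (x : Fin n → ℝ)
    (hx : ∀ i j, Q i j + (x j : EReal) ≤ x i) :
    ∃ y : Fin n → ℝ, (∀ i j, Q i j + (y j : EReal) ≤ y i) ∧
      (∀ i j, L i j + (y j : EReal) ≤ x i) ∧ ∀ i j, R i j + (x j : EReal) ≤ y i := by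
  have hsmall : ∀ q : Fin n × Fin n × Fin n, ∃ v : ℝ, L q.1 q.2.1 + Q q.2.1 q.2.2 + v ≤ x q.1 := by
    intro q
    have htop : L q.1 q.2.1 + Q q.2.1 q.2.2 ≠ ⊤ := EReal.add_ne_top (hL _ _) (hQtop _ _)
    generalize L q.1 q.2.1 + Q q.2.1 q.2.2 = z at *
    induction z with
    | bot => exact ⟨0, by simp⟩
    | coe z =>
      refine ⟨x q.1 - z, ?_⟩
      rw [← EReal.coe_add, add_sub_cancel]
    | top => exact absurd rfl htop
  choose f hf using hsmall
  obtain ⟨v, hv⟩ := Finite.exists_ge f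
  have hreal : ∀ b, ∃ w : ℝ, (w : EReal) = max (mpMulVec R (fun j => (x j : EReal)) b) v := by
    intro b
    refine ⟨_, EReal.coe_toReal ?_ ?_⟩
    · obtain ⟨j, hj⟩ := exists_eq_ciSup_of_finite (f := fun j => R b j + (x j : EReal))
      have hne : mpMulVec R (fun j => (x j : EReal)) b ≠ ⊤ := by
        rw [mpMulVec, ← hj]
        exact EReal.add_ne_top (hR _ _) (EReal.coe_ne_top _)
      exact (max_lt hne.lt_top (EReal.coe_lt_top _)).ne
    · exact ((EReal.bot_lt_coe v).trans_le (le_max_right _ _)).ne'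
  choose w hw using hreal
  obtain ⟨y, hwy, hy, hatt⟩ := exists_real_mpStar_closure (A := excMat L C R Q) (hQ ▸ hQtop) w
  rw [← hQ] at hy hatt
  refine ⟨y, hy, fun i a => ?_, fun i j => ?_⟩
  · obtain ⟨b, hb⟩ := hatt a
    obtain ⟨j, hj⟩ := exists_eq_ciSup_of_finite (f := fun j => R b j + (x j : EReal))
    rw [hb, ← add_assoc, hw b]
    rcases max_choice (mpMulVec R (fun j => (x j : EReal)) b) v with h | h
    · rw [h, mpMulVec, ← hj, ← add_assoc]
      refine (add_le_add_left ?_ _).trans (hx i j)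
      calc L i a + Q a b + R b j ≤ excMat L C R Q i j := le_excMat Q i a b j
        _ ≤ mpStar (excMat L C R Q) i j := le_mpStar _ i j
        _ = Q i j := by rw [← hQ]
    · rw [h]
      exact (add_le_add_right (EReal.coe_le_coe_iff.2 (hv (i, a, b))) _).trans (hf (i, a, b))
  · calc R i j + (x j : EReal) ≤ mpMulVec R (fun j => (x j : EReal)) i :=
          le_iSup (fun j => R i j + (x j : EReal)) j
      _ ≤ w i := (le_max_left _ _).trans_eq (hw i).symm
      _ ≤ y i := EReal.coe_le_coe_iff.2 (hwy i)

theorem consistent_of_eq_mpStar [Nonempty (Fin n)] {Q : Fin n → Fin n → EReal}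
    (hQ : Q = mpStar (excMat L C R Q)) (hQtop : ∀ i j, Q i j ≠ ⊤)
    (hL : ∀ i j, L i j ≠ ⊤) (hR : ∀ i j, R i j ≠ ⊤) : Consistent L C R := by
  obtain ⟨x₀, -, hx₀, -⟩ := exists_real_mpStar_closure (A := excMat L C R Q) (hQ ▸ hQtop) 0
  rw [← hQ] at hx₀
  choose next hnext hnextL hnextR using exists_next_of_eq_mpStar hQ hQtop hL hR
  let z : ℕ → {x : Fin n → ℝ // ∀ i j, Q i j + (x j : EReal) ≤ x i} := fun k =>
    Nat.rec ⟨x₀, hx₀⟩ (fun _ x => ⟨next x.1 x.2, hnext x.1 x.2⟩) k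
  have hCQ : C ≤ Q := by
    intro i j
    rw [hQ]
    exact (le_max_right _ _).trans (le_mpStar (excMat L C R Q) i j)
  exact ⟨fun k => (z k).1, fun k => ⟨fun i => iSup_le fun j => hnextL (z k).1 (z k).2 i j,
    fun i => iSup_le fun j => (add_le_add_left (hCQ i j) _).trans ((z k).2 i j),
    fun i => iSup_le fun j => hnextR (z k).1 (z k).2 i j⟩⟩

end Excursions

/-- system (8) is consistent iff `Π_{n²+1} = Π_{n²}` and no entry
of `Π_{n²}` equals `+∞`. -/
theorem stmt_8 (n : ℕ) (hn : 0 < n) (L C R : Fin n → Fin n → EReal)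
    (hL : ∀ i j, L i j ≠ ⊤) (hC : ∀ i j, C i j ≠ ⊤) (hR : ∀ i j, R i j ≠ ⊤) :
    Consistent L C R ↔
      (PiSeq L C R (n ^ 2 + 1) = PiSeq L C R (n ^ 2) ∧
       ∀ i j, PiSeq L C R (n ^ 2) i j ≠ ⊤) := by
  have : Nonempty (Fin n) := ⟨⟨0, hn⟩⟩
  constructor
  · intro h
    obtain ⟨P, hP, hPtop⟩ := h.exists_mpStar_excMat_le
    exact ⟨PiSeq_eq_of_mpStar_excMat_le hP hPtop, fun i j =>
      ne_top_of_le_ne_top (hPtop i j) (PiSeq_le_of_mpStar_excMat_le hP (n ^ 2) i j)⟩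
  · rintro ⟨h, htop⟩
    exact consistent_of_eq_mpStar h.symm htop hL hR
end
end
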